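/- There is an absolute constant C > 0 such that for every real r ≥ 2 and every real h: |I_r(h) − 2π h²/(log r + κ)| ≤ (C/r) · h²/(log r + κ). In particular, for any choice r = r(h) with r(h)·(log h)/h bounded above and below by positive constants, I_{r(h)}(h) ~ 2π h²/log h as h → ∞. -/

import Mathlib

open Filter Topology Classical

noncomputable section

abbrev Site : Type := ℤ × ℤ

/-- Nearest-neighbor adjacency in `ℤ²`. -/
def adjP (x y : Site) : Prop := |x.1 - y.1| + |x.2 - y.2| = 1

/-- The lattice ball `B_r = {x ∈ ℤ² : |x| ≤ r}`. -/
def ball (r : ℝ) : Finset Site :=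
  ((Finset.Icc (-⌈r⌉) ⌈r⌉) ×ˢ (Finset.Icc (-⌈r⌉) ⌈r⌉)).filter
    fun x => ((x.1 : ℝ) ^ 2 + (x.2 : ℝ) ^ 2 ≤ r ^ 2)

/-- The Dirichlet energy `∑_{x∼y} (φ_x - φ_y)²` over unordered nearest-neighbor pairs
(each ordered pair counted once, whence the factor 1/2). -/
def dirichletE (φ : Site → ℝ) : ℝ :=
  (1 / 2) * ∑' p : Site × Site, if adjP p.1 p.2 then (φ p.1 - φ p.2) ^ 2 else 0

/-- `I_r(h)`: infimum of the Dirichlet energy over real-valued `φ` vanishing off `B_r`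
with `φ_0 = h`. -/
def Ir (r : ℝ) (h : ℝ) : ℝ :=
  sInf {E | ∃ φ : Site → ℝ, (∀ x ∉ ball r, φ x = 0) ∧ φ (0, 0) = h ∧ E = dirichletE φ}

/-- `κ = γ_E + (3/2)·log 2`. -/
def κconst : ℝ := Real.eulerMascheroniConstant + (3 / 2) * Real.log 2

def lap (f : Site → ℝ) (x : Site) : ℝ :=
  f (x.1 + 1, x.2) + f (x.1 - 1, x.2) + f (x.1, x.2 + 1) + f (x.1, x.2 - 1) - 4 * f x

theorem max_principle (D : Finset Site) (f : Site → ℝ) (M : ℝ)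
    (hh : ∀ x ∈ D, 0 ≤ lap f x)
    (hb : ∀ x ∈ D, ∀ y, y ∉ D → adjP x y → f y ≤ M) : ∀ x ∈ D, f x ≤ M := by
  intro x0 hx0
  by_contra hcon
  push Not at hcon
  obtain ⟨xm, hxm, hmax⟩ := D.exists_max_image f ⟨x0, hx0⟩
  have hM : M < f xm := lt_of_lt_of_le hcon (hmax _ hx0)
  obtain ⟨z, hz, hzmax⟩ := (D.filter (fun x => f x = f xm)).exists_max_image (fun x => x.1)
    ⟨xm, by simp [hxm]⟩
  simp only [Finset.mem_filter] at hz hzmax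
  have key : ∀ y, adjP z y → f y ≤ f xm := by
    intro y hy
    by_cases hyD : y ∈ D
    · exact hmax _ hyD
    · exact (hb z hz.1 y hyD hy).trans hM.le
  have h1 := key (z.1 + 1, z.2) (by simp [adjP])
  have h2 := key (z.1 - 1, z.2) (by simp [adjP])
  have h3 := key (z.1, z.2 + 1) (by simp [adjP])
  have h4 := key (z.1, z.2 - 1) (by simp [adjP])
  have h5 := hh z hz.1
  unfold lap at h5
  rw [hz.2] at h5
  have h6 : f (z.1 + 1, z.2) = f xm := by linarith
  by_cases hyD : (z.1 + 1, z.2) ∈ D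
  · have := hzmax _ ⟨hyD, h6⟩
    simp at this
  · have := hb z hz.1 _ hyD (by simp [adjP])
    linarith

theorem lap_neg (f : Site → ℝ) (x : Site) : lap (fun z => - f z) x = - lap f x := by
  unfold lap; ring

theorem mem_ball {r : ℝ} (hr : 0 ≤ r) (x : Site) :
    x ∈ ball r ↔ (x.1 : ℝ) ^ 2 + (x.2 : ℝ) ^ 2 ≤ r ^ 2 := by
  unfold ball
  simp only [Finset.mem_filter, Finset.mem_product, Finset.mem_Icc, and_iff_right_iff_imp]
  intro h
  have h1 : |(x.1 : ℝ)| ≤ r := abs_le_of_sq_le_sq (by nlinarith [sq_nonneg (x.2 : ℝ)]) hr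
  have h2 : |(x.2 : ℝ)| ≤ r := abs_le_of_sq_le_sq (by nlinarith [sq_nonneg (x.1 : ℝ)]) hr
  have hc := Int.le_ceil r
  rw [abs_le] at h1 h2
  refine ⟨⟨?_, ?_⟩, ?_, ?_⟩ <;> (rw [← Int.cast_le (R := ℝ)]; push_cast; linarith)

/-- Extension by zero. -/
def ext0 (D : Finset Site) (u : D → ℝ) (x : Site) : ℝ := if h : x ∈ D then u ⟨x, h⟩ else 0

theorem exists_green (D : Finset Site) : ∃ G : Site → ℝ, (∀ x ∉ D, G x = 0) ∧
    ∀ x ∈ D, lap G x = if x = (0, 0) then -1 else 0 := by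
  let T : (D → ℝ) →ₗ[ℝ] (D → ℝ) :=
    { toFun := fun u x => lap (ext0 D u) x.1
      map_add' := by
        intro u v; funext x
        have : ∀ z, ext0 D (u + v) z = ext0 D u z + ext0 D v z := by
          intro z; unfold ext0; split <;> simp
        simp only [lap, this, Pi.add_apply]; ring
      map_smul' := by
        intro c u; funext x
        have : ∀ z, ext0 D (c • u) z = c * ext0 D u z := by
          intro z; unfold ext0; split <;> simp
        simp only [lap, this, Pi.smul_apply, smul_eq_mul, RingHom.id_apply]; ring }
  have hinj : Function.Injective T := by
    rw [injective_iff_map_eq_zero]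
    intro u hu
    have h0 : ∀ x ∈ D, lap (ext0 D u) x = 0 := fun x hx => congrFun hu ⟨x, hx⟩
    have hz : ∀ y, y ∉ D → ext0 D u y = 0 := by intro y hy; simp [ext0, hy]
    have a1 := max_principle D (ext0 D u) 0 (fun x hx => (h0 x hx).ge)
      (fun x hx y hy _ => (hz y hy).le)
    have a2 := max_principle D (fun z => - ext0 D u z) 0
      (fun x hx => by rw [lap_neg, h0 x hx]; simp)
      (fun x hx y hy _ => by rw [hz y hy]; simp)
    funext x
    have e : ext0 D u x.1 = u x := by simp [ext0]
    have b1 := a1 x.1 x.2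
    have b2 := a2 x.1 x.2
    simp only [e] at b1 b2
    simp only [Pi.zero_apply]; linarith
  obtain ⟨u, hu⟩ := (LinearMap.injective_iff_surjective.mp hinj)
    (fun x => if x.1 = (0, 0) then -1 else 0)
  exact ⟨ext0 D u, fun x hx => by simp [ext0, hx], fun x hx => congrFun hu ⟨x, hx⟩⟩

/-- adjacency kernel -/
def K (x y : Site) : ℝ := if adjP x y then 1 else 0

theorem K_symm (x y : Site) : K x y = K y x := by
  unfold K adjP
  rw [abs_sub_comm x.1, abs_sub_comm x.2]

def box (n : ℤ) : Finset Site := (Finset.Icc (-n) n) ×ˢ (Finset.Icc (-n) n)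

theorem adjP_iff (x y : Site) : adjP x y ↔ y = (x.1 + 1, x.2) ∨ y = (x.1 - 1, x.2) ∨
    y = (x.1, x.2 + 1) ∨ y = (x.1, x.2 - 1) := by
  obtain ⟨a, b⟩ := x
  obtain ⟨c, d⟩ := y
  simp only [adjP, Prod.mk.injEq]
  constructor
  · intro h
    rcases abs_cases (a - c) with h1 | h1 <;> rcases abs_cases (b - d) with h2 | h2 <;> omega
  · rintro (⟨rfl, rfl⟩ | ⟨rfl, rfl⟩ | ⟨rfl, rfl⟩ | ⟨rfl, rfl⟩) <;> simp

theorem sum_K (n : ℤ) (x : Site) (hx : x ∈ box n) (g : Site → ℝ) :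
    ∑ y ∈ box (n + 1), K x y * g y = g (x.1 + 1, x.2) + g (x.1 - 1, x.2) + g (x.1, x.2 + 1)
      + g (x.1, x.2 - 1) := by
  simp only [box, Finset.mem_product, Finset.mem_Icc] at hx
  have hs : ({(x.1 + 1, x.2), (x.1 - 1, x.2), (x.1, x.2 + 1), (x.1, x.2 - 1)} : Finset Site)
      ⊆ box (n + 1) := by
    intro y hy
    simp only [Finset.mem_insert, Finset.mem_singleton] at hy
    simp only [box, Finset.mem_product, Finset.mem_Icc]
    rcases hy with rfl | rfl | rfl | rfl <;> simp <;> omega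
  rw [← Finset.sum_subset hs]
  · rw [Finset.sum_insert, Finset.sum_insert, Finset.sum_insert, Finset.sum_singleton]
    · simp [K, adjP]; ring
    · simp; omega
    · simp
    · simp; omega
  · intro y _ hy
    have : ¬ adjP x y := by
      rw [adjP_iff]; simpa using hy
    simp [K, this]

/-- bilinear form -/
def Bf (n : ℤ) (φ ψ : Site → ℝ) : ℝ :=
  (1 / 2) * ∑ x ∈ box (n + 1), ∑ y ∈ box (n + 1), K x y * ((φ x - φ y) * (ψ x - ψ y))

theorem dirichletE_eq (n : ℤ) (φ : Site → ℝ) (h : ∀ x ∉ box n, φ x = 0) :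
    dirichletE φ = Bf n φ φ := by
  unfold dirichletE Bf
  congr 1
  rw [tsum_eq_sum (s := box (n + 1) ×ˢ box (n + 1)), Finset.sum_product]
  · apply Finset.sum_congr rfl; intro x _
    apply Finset.sum_congr rfl; intro y _
    simp only [K]; split <;> ring
  · rintro ⟨x, y⟩ hxy
    simp only
    split
    · rename_i had
      have h1 : ∀ z w : Site, adjP z w → z ∈ box n → w ∈ box (n + 1) := by
        intro z w hzw hz
        simp only [box, Finset.mem_product, Finset.mem_Icc] at hz ⊢
        rw [adjP_iff] at hzw
        rcases hzw with rfl | rfl | rfl | rfl <;> simp <;> omega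
      have hm : ∀ z : Site, z ∈ box n → z ∈ box (n + 1) := by
        intro z hz
        simp only [box, Finset.mem_product, Finset.mem_Icc] at hz ⊢
        omega
      have had' : adjP y x := by
        unfold adjP at *; rwa [abs_sub_comm y.1, abs_sub_comm y.2]
      simp only [Finset.mem_product, not_and_or] at hxy
      have hx : x ∉ box n := by
        rcases hxy with hx | hy
        · exact fun h => hx (hm _ h)
        · exact fun h => hy (h1 _ _ had h)
      have hy : y ∉ box n := by
        rcases hxy with hx | hy
        · exact fun h => hx (h1 _ _ had' h)
        · exact fun h => hy (hm _ h)
      simp [h x hx, h y hy]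
    · rfl

theorem Bf_eq (n : ℤ) (φ ψ : Site → ℝ) (h : ∀ x ∉ box n, φ x = 0) :
    Bf n φ ψ = - ∑ x ∈ box (n + 1), φ x * lap ψ x := by
  have e1 : ∑ x ∈ box (n + 1), ∑ y ∈ box (n + 1), K x y * ((φ x - φ y) * (ψ x - ψ y))
      = ∑ x ∈ box (n + 1), ∑ y ∈ box (n + 1), K x y * (φ x * (ψ x - ψ y)) +
        ∑ x ∈ box (n + 1), ∑ y ∈ box (n + 1), K x y * (φ y * (ψ y - ψ x)) := by
    rw [← Finset.sum_add_distrib]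
    apply Finset.sum_congr rfl; intro x _
    rw [← Finset.sum_add_distrib]
    apply Finset.sum_congr rfl; intro y _
    ring
  have e2 : ∑ x ∈ box (n + 1), ∑ y ∈ box (n + 1), K x y * (φ y * (ψ y - ψ x)) =
      ∑ x ∈ box (n + 1), ∑ y ∈ box (n + 1), K x y * (φ x * (ψ x - ψ y)) := by
    rw [Finset.sum_comm]
    apply Finset.sum_congr rfl; intro x _
    apply Finset.sum_congr rfl; intro y _
    rw [K_symm]
  have e3 : ∀ x ∈ box (n + 1), ∑ y ∈ box (n + 1), K x y * (φ x * (ψ x - ψ y)) =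
      - (φ x * lap ψ x) := by
    intro x _
    by_cases hx : x ∈ box n
    · rw [sum_K n x hx (fun y => φ x * (ψ x - ψ y))]
      unfold lap; ring
    · simp [h x hx]
  unfold Bf
  rw [e1, e2, Finset.sum_congr rfl e3, Finset.sum_neg_distrib]
  ring

theorem Bf_nonneg (n : ℤ) (φ : Site → ℝ) : 0 ≤ Bf n φ φ := by
  unfold Bf
  apply mul_nonneg (by norm_num)
  apply Finset.sum_nonneg; intro x _
  apply Finset.sum_nonneg; intro y _
  unfold K
  split
  · nlinarith [mul_self_nonneg (φ x - φ y)]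
  · simp

theorem Bf_lin (n : ℤ) (φ ψ : Site → ℝ) (t : ℝ) :
    Bf n (fun x => φ x - t * ψ x) (fun x => φ x - t * ψ x) =
      Bf n φ φ - 2 * t * Bf n φ ψ + t ^ 2 * Bf n ψ ψ := by
  simp only [Bf, Finset.mul_sum, ← Finset.sum_add_distrib, ← Finset.sum_sub_distrib]
  apply Finset.sum_congr rfl; intro x _
  apply Finset.sum_congr rfl; intro y _
  ring

theorem Ir_eq_green (r : ℝ) (hr : 1 ≤ r) (a : Site → ℝ)
    (ha : ∀ x, lap a x = if x = (0, 0) then 1 else 0) (ha0 : a (0, 0) = 0) (m M : ℝ)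
    (hm : ∀ x : Site, r ^ 2 < (x.1 : ℝ) ^ 2 + (x.2 : ℝ) ^ 2 →
      (x.1 : ℝ) ^ 2 + (x.2 : ℝ) ^ 2 ≤ (r + 1) ^ 2 → m ≤ a x ∧ a x ≤ M) :
    ∃ g : ℝ, 1 / 4 ≤ g ∧ m ≤ g ∧ g ≤ M ∧ ∀ h, Ir r h = h ^ 2 / g := by
  have hr0 : 0 ≤ r := by linarith
  obtain ⟨G, hG0, hG⟩ := exists_green (ball r)
  have h0mem : ((0, 0) : Site) ∈ ball r := by
    rw [mem_ball hr0]; simp; positivity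
  have hbd : ∀ x ∈ ball r, ∀ y, y ∉ ball r → adjP x y →
      m ≤ a y ∧ a y ≤ M := by
    intro x hx y hy hxy
    rw [mem_ball hr0] at hx hy
    apply hm y (by linarith)
    have h1 : |(x.1 : ℝ)| ≤ r := abs_le_of_sq_le_sq (by nlinarith [sq_nonneg (x.2 : ℝ)]) hr0
    have h2 : |(x.2 : ℝ)| ≤ r := abs_le_of_sq_le_sq (by nlinarith [sq_nonneg (x.1 : ℝ)]) hr0
    rw [abs_le] at h1 h2
    rw [adjP_iff] at hxy
    rcases hxy with rfl | rfl | rfl | rfl <;> push_cast <;> nlinarith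
  have hGpos : ∀ x, 0 ≤ G x := by
    intro x
    by_cases hx : x ∈ ball r
    · have := max_principle (ball r) (fun z => - G z) 0
        (fun x hx => by rw [lap_neg, hG x hx]; split <;> norm_num)
        (fun x hx y hy _ => by rw [hG0 y hy]; simp) x hx
      linarith
    · rw [hG0 x hx]
  have hlapadd : ∀ x ∈ ball r, lap (fun z => G z + a z) x = 0 := by
    intro x hx
    have : lap (fun z => G z + a z) x = lap G x + lap a x := by unfold lap; ring
    rw [this, hG x hx, ha x]; split <;> norm_num
  have hup := max_principle (ball r) (fun z => G z + a z) M
    (fun x hx => (hlapadd x hx).ge)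
    (fun x hx y hy hxy => by simpa [hG0 y hy] using (hbd x hx y hy hxy).2) _ h0mem
  have hlo := max_principle (ball r) (fun z => - (G z + a z)) (-m)
    (fun x hx => by rw [lap_neg, hlapadd x hx]; simp)
    (fun x hx y hy hxy => by simpa [hG0 y hy] using (hbd x hx y hy hxy).1) _ h0mem
  simp only [ha0, add_zero] at hup hlo
  have hq : 1 / 4 ≤ G (0, 0) := by
    have := hG _ h0mem
    simp only [lap, if_true] at this
    have := hGpos (0 + 1, 0)
    have := hGpos (0 - 1, 0)
    have := hGpos (0, 0 + 1)
    have := hGpos (0, 0 - 1)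
    linarith
  have hsub : ∀ x, x ∉ box ⌈r⌉ → x ∉ ball r := by
    intro x hx hb
    apply hx
    unfold ball at hb
    exact (Finset.mem_filter.mp hb).1
  have hB : ∀ φ : Site → ℝ, (∀ x ∉ ball r, φ x = 0) → Bf ⌈r⌉ φ G = φ (0, 0) := by
    intro φ hφ
    rw [Bf_eq _ _ _ (fun x hx => hφ x (hsub x hx)), ← Finset.sum_neg_distrib]
    rw [Finset.sum_eq_single (0, 0)]
    · rw [hG _ h0mem]; simp
    · intro x _ hx0
      by_cases hx : x ∈ ball r
      · rw [hG x hx]; simp [hx0]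
      · rw [hφ x hx]; simp
    · intro hn
      exfalso; apply hn
      have := Int.ceil_nonneg hr0
      simp [box]; omega
  have hEG : Bf ⌈r⌉ G G = G (0, 0) := hB G hG0
  have hg : 0 < G (0, 0) := by linarith
  refine ⟨G (0, 0), hq, by linarith, hup, fun h => ?_⟩
  unfold Ir
  apply IsLeast.csInf_eq
  constructor
  · refine ⟨fun x => h / G (0, 0) * G x, fun x hx => by simp [hG0 x hx], by field_simp, ?_⟩
    rw [dirichletE_eq ⌈r⌉ _ (fun x hx => by simp [hG0 x (hsub x hx)])]
    have := Bf_lin ⌈r⌉ (fun _ => 0) G (-(h / G (0, 0)))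
    have e : (fun x => (0 : ℝ) - -(h / G (0, 0)) * G x) = fun x => h / G (0, 0) * G x := by
      funext x; ring
    rw [e] at this
    rw [this, hEG]
    simp [Bf]
    field_simp
  · rintro E ⟨φ, hφ, hφ0, rfl⟩
    rw [dirichletE_eq ⌈r⌉ _ (fun x hx => hφ x (hsub x hx))]
    have h1 := Bf_nonneg ⌈r⌉ (fun x => φ x - (h / G (0, 0)) * G x)
    rw [Bf_lin, hB φ hφ, hEG, hφ0] at h1
    have e : Bf ⌈r⌉ φ φ - 2 * (h / G (0, 0)) * h + (h / G (0, 0)) ^ 2 * G (0, 0) =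
      Bf ⌈r⌉ φ φ - h ^ 2 / G (0, 0) := by field_simp; ring
    linarith

def sn (t : ℝ) : ℝ := Real.sin (t / 2)
def al (t : ℝ) : ℝ := 2 * Real.arsinh (sn t)
def Sh (t : ℝ) : ℝ := 2 * sn t * √(1 + sn t ^ 2)

theorem sinh_al (t : ℝ) : Real.sinh (al t) = Sh t := by
  unfold al Sh
  rw [Real.sinh_two_mul, Real.sinh_arsinh, Real.cosh_arsinh]

theorem cosh_al (t : ℝ) : Real.cosh (al t) = 2 - Real.cos t := by
  unfold al
  rw [Real.cosh_two_mul, Real.cosh_sq, Real.sinh_arsinh]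
  have := Real.cos_sq (t / 2)
  have h2 := Real.sin_sq_add_cos_sq (t / 2)
  rw [show 2 * (t / 2) = t by ring] at this
  unfold sn
  linarith

theorem sn_ge {t : ℝ} (h0 : 0 < t) (h1 : t ≤ Real.pi) : t / Real.pi ≤ sn t := by
  have := Real.mul_le_sin (x := t / 2) (by linarith) (by linarith)
  unfold sn
  refine le_trans (le_of_eq ?_) this
  ring

theorem sn_pos {t : ℝ} (h0 : 0 < t) (h1 : t ≤ Real.pi) : 0 < sn t :=
  lt_of_lt_of_le (div_pos h0 Real.pi_pos) (sn_ge h0 h1)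

theorem sn_le_one (t : ℝ) : sn t ≤ 1 := Real.sin_le_one _

theorem sn_le {t : ℝ} (h0 : 0 < t) : sn t ≤ t / 2 := Real.sin_le (by linarith)

theorem sn_cube {t : ℝ} (h0 : 0 < t) (h1 : t ≤ Real.pi) : t - 2 * sn t ≤ t ^ 3 / 4 := by
  by_cases h : t / 2 ≤ 1
  · have := Real.sin_gt_sub_cube (x := t / 2) (by linarith)
    unfold sn
    have : 0 < t ^ 3 := by positivity
    nlinarith
  · push Not at h
    have := sn_pos h0 h1
    nlinarith [mul_pos h0 h0]

theorem sqrt_ge (t : ℝ) : 1 ≤ √(1 + sn t ^ 2) := by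
  rw [Real.one_le_sqrt]; nlinarith [sq_nonneg (sn t)]

theorem sqrt_le (t : ℝ) : √(1 + sn t ^ 2) ≤ 1 + sn t ^ 2 / 2 := by
  rw [Real.sqrt_le_left (by positivity)]; nlinarith [sq_nonneg (sn t ^ 2)]

theorem Sh_ge {t : ℝ} (h0 : 0 < t) (h1 : t ≤ Real.pi) : 2 * t / Real.pi ≤ Sh t := by
  have := sn_ge h0 h1
  have h2 := sn_pos h0 h1
  unfold Sh
  have := sqrt_ge t
  calc 2 * t / Real.pi = 2 * (t / Real.pi) := by ring
    _ ≤ 2 * sn t := by linarith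
    _ ≤ _ := by nlinarith

theorem Sh_pos {t : ℝ} (h0 : 0 < t) (h1 : t ≤ Real.pi) : 0 < Sh t :=
  lt_of_lt_of_le (by positivity) (Sh_ge h0 h1)

theorem Sh_sub {t : ℝ} (h0 : 0 < t) (h1 : t ≤ Real.pi) : |Sh t - t| ≤ t ^ 3 / 4 := by
  have a1 := sn_cube h0 h1
  have a2 := sn_pos h0 h1
  have a3 := sqrt_ge t
  have a4 := sqrt_le t
  have a5 := sn_le h0
  have a6 : sn t ^ 3 ≤ (t / 2) ^ 3 := by gcongr
  have a7 : 0 < t ^ 3 := by positivity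
  unfold Sh
  rw [abs_le]
  constructor
  · nlinarith
  · have : 2 * sn t * √(1 + sn t ^ 2) ≤ 2 * sn t * (1 + sn t ^ 2 / 2) := by gcongr
    nlinarith

theorem arsinh_le_self {s : ℝ} (hs : 0 ≤ s) : Real.arsinh s ≤ s := by
  have := Real.self_le_sinh_iff.mpr (Real.arsinh_nonneg_iff.mpr hs)
  rwa [Real.sinh_arsinh] at this

theorem arsinh_ge {s : ℝ} (hs : 0 ≤ s) : s - s ^ 3 / 2 ≤ Real.arsinh s := by
  have hd : ∀ x : ℝ, HasDerivAt (fun x => Real.arsinh x - (x - x ^ 3 / 2))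
      ((√(1 + x ^ 2))⁻¹ - (1 - 3 * x ^ 2 / 2)) x := by
    intro x
    refine (Real.hasDerivAt_arsinh x).sub ((hasDerivAt_id' x).sub ?_)
    refine ((hasDerivAt_pow 3 x).div_const 2).congr_deriv ?_
    norm_num
  have hm : Monotone (fun x => Real.arsinh x - (x - x ^ 3 / 2)) := by
    apply monotone_of_hasDerivAt_nonneg hd
    intro x
    simp only [Pi.zero_apply]
    have h1 : √(1 + x ^ 2) ≤ 1 + x ^ 2 / 2 := by
      rw [Real.sqrt_le_left (by positivity)]; nlinarith [sq_nonneg (x ^ 2)]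
    have h2 : 0 < √(1 + x ^ 2) := by positivity
    have h3 : (1 + x ^ 2 / 2)⁻¹ ≤ (√(1 + x ^ 2))⁻¹ := by gcongr
    have h4 : 1 - 3 * x ^ 2 / 2 ≤ (1 + x ^ 2 / 2)⁻¹ := by
      rw [← one_div, le_div_iff₀ (by positivity)]
      nlinarith [sq_nonneg (x ^ 2), sq_nonneg x]
    linarith
  have := hm hs
  simp at this
  linarith

theorem al_le {t : ℝ} (h0 : 0 < t) (h1 : t ≤ Real.pi) : al t ≤ t := by
  have := arsinh_le_self (sn_pos h0 h1).le
  have := sn_le h0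
  unfold al; linarith

theorem al_ge {t : ℝ} (h0 : 0 < t) (h1 : t ≤ Real.pi) : t / Real.pi ≤ al t := by
  have := arsinh_ge (sn_pos h0 h1).le
  have h2 := sn_ge h0 h1
  have h3 := sn_pos h0 h1
  have h4 := sn_le_one t
  unfold al
  have : sn t ^ 3 ≤ sn t := by nlinarith [mul_nonneg h3.le (sub_nonneg.mpr h4)]
  linarith

theorem al_sub {t : ℝ} (h0 : 0 < t) (h1 : t ≤ Real.pi) : t - al t ≤ t ^ 3 := by
  have := arsinh_ge (sn_pos h0 h1).le
  have h2 := sn_cube h0 h1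
  have h3 := sn_pos h0 h1
  have a6 : sn t ^ 3 ≤ (t / 2) ^ 3 := by have := sn_le h0; gcongr
  have a7 : 0 < t ^ 3 := by positivity
  unfold al
  nlinarith

theorem inv_sub {t : ℝ} (h0 : 0 < t) (h1 : t ≤ Real.pi) : |1 / Sh t - 1 / t| ≤ t := by
  have h2 := Sh_pos h0 h1
  have h3 := Sh_ge h0 h1
  have h4 := Sh_sub h0 h1
  have e : 1 / Sh t - 1 / t = - (Sh t - t) / (Sh t * t) := by field_simp; ring
  rw [e, abs_div, abs_neg, abs_of_pos (by positivity : 0 < Sh t * t), div_le_iff₀ (by positivity)]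
  have h5 : t / 2 ≤ Sh t := by
    refine le_trans ?_ h3
    rw [div_le_div_iff₀ (by norm_num) Real.pi_pos]
    nlinarith [Real.pi_lt_four]
  have : t ^ 3 / 4 ≤ t * (t / 2 * t) := by nlinarith [pow_pos h0 3]
  refine h4.trans (this.trans ?_)
  gcongr

theorem measurable_sn : Measurable sn := by unfold sn; fun_prop
theorem continuous_sn : Continuous sn := by unfold sn; fun_prop
theorem continuous_al : Continuous al := by
  unfold al; exact continuous_const.mul (Real.continuous_arsinh.comp continuous_sn)
theorem continuous_Sh : Continuous Sh := by
  unfold Sh; have := continuous_sn; fun_prop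

/-- bounded measurable functions are interval integrable -/
theorem ii_of_bdd {f : ℝ → ℝ} (hf : Measurable f) (b C : ℝ) (hb : 0 ≤ b)
    (h : ∀ t, 0 < t → t ≤ b → |f t| ≤ C) : IntervalIntegrable f MeasureTheory.volume 0 b := by
  rw [intervalIntegrable_iff, Set.uIoc_of_le hb]
  apply MeasureTheory.Measure.integrableOn_of_bounded (M := C)
  · simp
  · exact hf.aestronglyMeasurable
  · rw [MeasureTheory.ae_restrict_iff' measurableSet_Ioc]
    exact MeasureTheory.ae_of_all _ (fun t ht => h t ht.1 ht.2)

theorem ii_bound {f : ℝ → ℝ} (a b C : ℝ) (hb : a ≤ b)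
    (h : ∀ t, a < t → t ≤ b → |f t| ≤ C) : |∫ t in a..b, f t| ≤ C * (b - a) := by
  have := intervalIntegral.norm_integral_le_of_norm_le_const (a := a) (b := b) (f := f) (C := C)
    (fun t ht => by rw [Set.uIoc_of_le hb] at ht; exact h t ht.1 ht.2)
  rwa [abs_of_nonneg (by linarith : 0 ≤ b - a)] at this

/-- P4 -/
theorem exp_bound1 {u : ℝ} (_hu : 0 ≤ u) : u * Real.exp (-u) ≤ 1 := by
  rw [Real.exp_neg, ← div_eq_mul_inv, div_le_one (Real.exp_pos _)]
  linarith [Real.add_one_le_exp u]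

theorem exp_bound2 {u : ℝ} (hu : 0 ≤ u) : u ^ 2 * Real.exp (-u) ≤ 2 := by
  rw [Real.exp_neg, ← div_eq_mul_inv, div_le_iff₀ (Real.exp_pos _)]
  linarith [Real.quadratic_le_exp_of_nonneg hu]

theorem P4_pt {t n : ℝ} (h0 : 0 < t) (h1 : t ≤ Real.pi) (hn : 0 < n) :
    |Real.exp (-(al t * n)) / Sh t - Real.exp (-(t * n)) / t| ≤ 100 / n := by
  have hpi := Real.pi_pos
  set E := Real.exp (-(t * n / Real.pi)) with hE
  have i1 := inv_sub h0 h1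
  have i2 := al_le h0 h1
  have i3 := al_ge h0 h1
  have i4 := al_sub h0 h1
  have i5 := Sh_ge h0 h1
  have i6 := Sh_pos h0 h1
  have e1 : Real.exp (-(al t * n)) / Sh t - Real.exp (-(t * n)) / t =
    (Real.exp (-(al t * n)) - Real.exp (-(t * n))) / Sh t
      + Real.exp (-(t * n)) * (1 / Sh t - 1 / t) := by ring
  have b1 : Real.exp (-(al t * n)) ≤ E := by
    apply Real.exp_le_exp.mpr
    have : t / Real.pi * n ≤ al t * n := by gcongr
    have e : t / Real.pi * n = t * n / Real.pi := by ring
    linarith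
  have b2 : Real.exp (-(t * n)) ≤ Real.exp (-(al t * n)) := by
    apply Real.exp_le_exp.mpr
    have : al t * n ≤ t * n := by gcongr
    linarith
  have b3 : Real.exp (-(al t * n)) - Real.exp (-(t * n)) ≤ n * t ^ 3 * E := by
    have : Real.exp (-(t * n)) = Real.exp (-(al t * n)) * Real.exp (-((t - al t) * n)) := by
      rw [← Real.exp_add]; ring_nf
    rw [this]
    have h6 := Real.add_one_le_exp (-((t - al t) * n))
    have h7 := Real.exp_pos (-(al t * n))
    have h8 : (t - al t) * n ≤ n * t ^ 3 := by nlinarith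
    have h9 : 0 ≤ n * t ^ 3 := by positivity
    calc _ = Real.exp (-(al t * n)) * (1 - Real.exp (-((t - al t) * n))) := by ring
      _ ≤ Real.exp (-(al t * n)) * (n * t ^ 3) := by gcongr; linarith
      _ ≤ E * (n * t ^ 3) := by gcongr
      _ = _ := by ring
  have u0 : 0 ≤ t * n / Real.pi := by positivity
  have c1 := exp_bound1 u0
  have c2 := exp_bound2 u0
  rw [← hE] at c1 c2
  have d1 : |(Real.exp (-(al t * n)) - Real.exp (-(t * n))) / Sh t| ≤ Real.pi ^ 3 / n := by
    rw [abs_div, abs_of_nonneg (by linarith), abs_of_pos i6, div_le_iff₀ i6]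
    refine b3.trans ?_
    have : Real.pi ^ 3 / n * (2 * t / Real.pi) ≤ Real.pi ^ 3 / n * Sh t := by gcongr
    refine le_trans ?_ this
    have e : n * t ^ 3 * E = Real.pi ^ 2 * t / n * ((t * n / Real.pi) ^ 2 * E) := by
      field_simp
    rw [e]
    calc _ ≤ Real.pi ^ 2 * t / n * 2 := by gcongr
      _ = _ := by field_simp
  have d2 : |Real.exp (-(t * n)) * (1 / Sh t - 1 / t)| ≤ Real.pi / n := by
    rw [abs_mul, abs_of_pos (Real.exp_pos _)]
    calc _ ≤ E * t := by gcongr; exact b2.trans b1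
      _ = Real.pi / n * (t * n / Real.pi * E) := by field_simp
      _ ≤ Real.pi / n * 1 := by gcongr
      _ = _ := by ring
  rw [e1]
  refine (abs_add_le _ _).trans ((add_le_add d1 d2).trans ?_)
  rw [← add_div]
  gcongr
  have p1 := Real.pi_lt_four
  have : Real.pi ^ 3 ≤ 4 ^ 3 := by gcongr
  linarith

theorem P1 : ∫ t in (0:ℝ)..Real.pi, (1 / Sh t - 1 / t) = 3 / 2 * Real.log 2 - Real.log Real.pi := by
  have hpi := Real.pi_pos
  let F : ℝ → ℝ := fun t => Real.log (Real.sinc (t / 2) / 2) -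
    Real.log (√(1 + sn t ^ 2) + Real.cos (t / 2))
  have hq : ∀ t, 0 ≤ t → t ≤ Real.pi → 0 < √(1 + sn t ^ 2) + Real.cos (t / 2) := by
    intro t h0 h1
    have := Real.cos_nonneg_of_neg_pi_div_two_le_of_le (x := t / 2) (by linarith) (by linarith)
    linarith [sqrt_ge t]
  have hs : ∀ t, 0 ≤ t → t ≤ Real.pi → 0 < Real.sinc (t / 2) := by
    intro t h0 h1
    rcases h0.eq_or_lt with rfl | h0
    · simp
    · rw [Real.sinc_of_ne_zero (by positivity)]
      exact div_pos (sn_pos h0 h1) (by positivity)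
  have key := intervalIntegral.integral_eq_sub_of_hasDerivAt_of_le (f := F)
    (f' := fun t => 1 / Sh t - 1 / t) hpi.le ?_ ?_ ?_
  · rw [key]
    simp only [F, sn]
    rw [Real.sinc_of_ne_zero (by positivity : Real.pi / 2 ≠ 0)]
    simp
    rw [Real.log_div (by norm_num) (by norm_num), show (1:ℝ)+1 = 2 by norm_num, Real.log_sqrt (by norm_num),
      Real.log_div (by norm_num) (by positivity)]
    ring
  · apply ContinuousOn.sub
    · apply ContinuousOn.log
      · have := Real.continuous_sinc
        fun_prop
      · intro t ht; have := hs t ht.1 ht.2; positivity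
    · apply ContinuousOn.log
      · have := continuous_sn
        fun_prop
      · intro t ht; exact (hq t ht.1 ht.2).ne'
  · intro t ht
    have hs0 := sn_pos ht.1 ht.2.le
    have hq0 := hq t ht.1.le ht.2.le
    have dsn : HasDerivAt sn (Real.cos (t / 2) * (1 / 2)) t := by
      unfold sn
      exact (((hasDerivAt_id' t).div_const 2).sin)
    have dcos : HasDerivAt (fun t => Real.cos (t / 2)) (- Real.sin (t / 2) * (1 / 2)) t := by
      exact (((hasDerivAt_id' t).div_const 2).cos)
    have hR0 : 0 < √(1 + sn t ^ 2) := by positivity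
    have dsq : HasDerivAt (fun t => √(1 + sn t ^ 2))
        (sn t * Real.cos (t / 2) / (2 * √(1 + sn t ^ 2))) t := by
      refine (((dsn.pow 2).const_add 1).sqrt ?_).congr_deriv ?_
      · have : 0 < 1 + sn t ^ 2 := by positivity
        exact this.ne'
      · simp only [Pi.pow_apply]
        norm_num
        ring
    have d : HasDerivAt (fun t => Real.log (sn t) - Real.log t -
        Real.log (√(1 + sn t ^ 2) + Real.cos (t / 2)))
        (Real.cos (t / 2) * (1 / 2) / sn t - t⁻¹ -
          (sn t * Real.cos (t / 2) / (2 * √(1 + sn t ^ 2)) + - Real.sin (t / 2) * (1 / 2)) /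
            (√(1 + sn t ^ 2) + Real.cos (t / 2))) t :=
      (((dsn.log hs0.ne').sub (Real.hasDerivAt_log ht.1.ne'))).sub
        ((dsq.add dcos).log hq0.ne')
    have heq : F =ᶠ[𝓝 t] fun t => Real.log (sn t) - Real.log t -
        Real.log (√(1 + sn t ^ 2) + Real.cos (t / 2)) := by
      filter_upwards [Ioo_mem_nhds ht.1 ht.2] with u hu
      have h1 := sn_pos hu.1 hu.2.le
      have h2 := hu.1
      simp only [F]
      rw [Real.sinc_of_ne_zero (by positivity), ← Real.log_div h1.ne' h2.ne']
      congr 2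
      unfold sn; field_simp
    refine (d.congr_of_eventuallyEq heq).congr_deriv ?_
    have hsc := Real.sin_sq_add_cos_sq (t / 2)
    unfold Sh
    change sn t ^ 2 + _ = 1 at hsc
    change _ - (_ + (- sn t) * _) / _ = _
    have hR := Real.sq_sqrt (show 0 ≤ 1 + sn t ^ 2 by positivity)
    set R := √(1 + sn t ^ 2)
    set c := Real.cos (t / 2)
    set s := sn t
    have ht0 := ht.1
    have main : c * (1 / 2) / s - (s * c / (2 * R) + -s * (1 / 2)) / (R + c) = 1 / (2 * s * R) := by
      field_simp
      linear_combination c * hR + R * hsc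
    rw [← main]; ring
  · apply ii_of_bdd (C := Real.pi) _ _ hpi.le
    · intro t h0 h1; exact (inv_sub h0 h1).trans h1
    · have := continuous_Sh.measurable
      fun_prop

theorem harm_int (n : ℕ) : ∫ t in (0:ℝ)..1, (1 - (1 - t) ^ n) / t = (harmonic n : ℝ) := by
  have e : ∫ t in (0:ℝ)..1, (1 - (1 - t) ^ n) / t =
      ∫ t in (0:ℝ)..1, ∑ k ∈ Finset.range n, (1 - t) ^ k := by
    apply intervalIntegral.integral_congr_ae
    refine MeasureTheory.ae_of_all _ (fun t ht => ?_)
    rw [Set.uIoc_of_le (by norm_num)] at ht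
    have := mul_neg_geom_sum (1 - t) n
    rw [div_eq_iff ht.1.ne', ← this]; ring
  rw [e, intervalIntegral.integral_finsetSum]
  · rw [harmonic]
    push_cast
    apply Finset.sum_congr rfl
    intro k _
    rw [intervalIntegral.integral_comp_sub_left (fun u => u ^ k) 1]
    simp
  · intro k _
    apply Continuous.intervalIntegrable; fun_prop

theorem exp_pow_sub (n : ℕ) {t : ℝ} (h0 : 0 < t) (h1 : t ≤ 1) :
    |(Real.exp (-(t * n)) - (1 - t) ^ n) / t| ≤ n * t * Real.exp (-(t * n)) := by
  have hp := Real.exp_pos (t * n)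
  have hp2 := Real.exp_pos (-(t * n))
  have e0 : Real.exp (t * n) = Real.exp t ^ n := by
    rw [← Real.exp_nat_mul]; ring_nf
  have e1 : Real.exp (-(t * n)) = Real.exp (-t) ^ n := by
    rw [← Real.exp_nat_mul]; ring_nf
  have lo : (1 - t) ^ n ≤ Real.exp (-(t * n)) := by
    rw [e1]; apply pow_le_pow_left₀ (by linarith); exact Real.one_sub_le_exp_neg t
  have hb := one_add_mul_le_pow (a := (1 - t) * Real.exp t - 1)
    (by nlinarith [Real.exp_pos t]) n
  have e2 : (1 + ((1 - t) * Real.exp t - 1)) ^ n = (1 - t) ^ n * Real.exp (t * n) := by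
    rw [e0, ← mul_pow]; ring
  rw [e2] at hb
  have h3 : 1 - t ^ 2 ≤ (1 - t) * Real.exp t := by
    nlinarith [Real.add_one_le_exp t]
  have h4 : 1 - n * t ^ 2 ≤ (1 - t) ^ n * Real.exp (t * n) := by
    have : (n : ℝ) * (-t ^ 2) ≤ n * ((1 - t) * Real.exp t - 1) := by gcongr; linarith
    linarith
  have h5 : (1 - n * t ^ 2) * Real.exp (-(t * n)) ≤ (1 - t) ^ n := by
    have := mul_le_mul_of_nonneg_right h4 hp2.le
    rwa [mul_assoc, ← Real.exp_add, add_neg_cancel, Real.exp_zero, mul_one] at this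
  rw [abs_of_nonneg (div_nonneg (by linarith) h0.le), div_le_iff₀ h0]
  nlinarith

theorem int_te (n : ℕ) (hn : 1 ≤ n) :
    ∫ t in (0:ℝ)..1, n * t * Real.exp (-(t * n)) ≤ 1 / n := by
  have hn0 : (0:ℝ) < n := by exact_mod_cast hn
  rw [intervalIntegral.integral_eq_sub_of_hasDerivAt
    (f := fun t : ℝ => -((t + 1 / n) * Real.exp (-(t * n))))]
  · simp
    have := Real.exp_pos (-(n:ℝ))
    positivity
  · intro t _
    have d1 : HasDerivAt (fun t : ℝ => Real.exp (-(t * n))) (Real.exp (-(t * n)) * (-(1 * n))) t :=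
      (((hasDerivAt_id' t).mul_const (n:ℝ)).neg).exp
    refine ((((hasDerivAt_id' t).add_const (1 / (n:ℝ))).mul d1).neg).congr_deriv ?_
    field_simp; ring
  · apply Continuous.intervalIntegrable; fun_prop

theorem one_sub_exp_le {u : ℝ} : 1 - Real.exp (-u) ≤ u := by
  linarith [Real.add_one_le_exp (-u)]

theorem P2_ii (n b : ℝ) (hb : 0 ≤ b) (hn : 0 ≤ n) : IntervalIntegrable
    (fun t => (1 - Real.exp (-(t * n))) / t) MeasureTheory.volume 0 b := by
  apply ii_of_bdd (C := n) _ _ hb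
  · intro t h0 h1
    have : Real.exp (-(t * n)) ≤ 1 := by
      rw [Real.exp_le_one_iff]; have := mul_nonneg h0.le hn; linarith
    rw [abs_of_nonneg (div_nonneg (by linarith) h0.le), div_le_iff₀ h0]
    linarith [one_sub_exp_le (u := t * n)]
  · fun_prop

theorem P2 (n : ℕ) (hn : 1 ≤ n) :
    |(∫ t in (0:ℝ)..Real.pi, (1 - Real.exp (-(t * n))) / t) -
      (Real.log n + Real.eulerMascheroniConstant + Real.log Real.pi)| ≤ 6 / n := by
  have hn0 : (0:ℝ) < n := by exact_mod_cast hn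
  have hpi := Real.pi_gt_three
  have i1 := P2_ii n 1 (by norm_num) hn0.le
  have i2 := P2_ii n Real.pi (by linarith) hn0.le
  have i3 : IntervalIntegrable (fun t => (1 - Real.exp (-(t * n))) / t)
    MeasureTheory.volume 1 Real.pi := i1.symm.trans i2
  rw [← intervalIntegral.integral_add_adjacent_intervals i1 i3]
  have hinv : IntervalIntegrable (fun t : ℝ => 1 / t) MeasureTheory.volume 1 Real.pi := by
    apply ContinuousOn.intervalIntegrable
    rw [Set.uIcc_of_le (by linarith)]
    apply ContinuousOn.div continuousOn_const continuousOn_id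
    intro t ht
    have := ht.1
    simp; linarith
  have a1 : |(∫ t in (1:ℝ)..Real.pi, (1 - Real.exp (-(t * n))) / t) - Real.log Real.pi| ≤ 3 / n := by
    have e : Real.log Real.pi = ∫ t in (1:ℝ)..Real.pi, 1 / t := by
      rw [integral_one_div_of_pos (by norm_num) (by linarith)]; simp
    rw [e, ← intervalIntegral.integral_sub i3 hinv]
    refine (ii_bound _ _ (1 / n) (by linarith) ?_).trans ?_
    · intro t h0 _
      have h0' : 0 < t := by linarith
      have e : (1 - Real.exp (-(t * n))) / t - 1 / t = - (Real.exp (-(t * n)) / t) := by ring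
      rw [e, abs_neg, abs_of_pos (by positivity)]
      have h1 := exp_bound1 (u := t * n) (by positivity)
      have h2 := Real.exp_pos (-(t * n))
      rw [div_le_div_iff₀ h0' hn0]
      nlinarith
    · have := Real.pi_lt_four
      rw [div_mul_eq_mul_div]
      gcongr; linarith
  have a2 : |(∫ t in (0:ℝ)..1, (1 - Real.exp (-(t * n))) / t) - (harmonic n : ℝ)| ≤ 1 / n := by
    have i4 : IntervalIntegrable (fun t : ℝ => (1 - (1 - t) ^ n) / t)
        MeasureTheory.volume 0 1 := by
      apply ii_of_bdd (C := n) _ _ (by norm_num)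
      · intro t h0 h1
        have h2 : (1 - t) ^ n ≤ 1 := pow_le_one₀ (by linarith) (by linarith)
        have h3 := one_add_mul_le_pow (a := -t) (by linarith) n
        rw [abs_of_nonneg (div_nonneg (by linarith) h0.le), div_le_iff₀ h0]
        rw [← sub_eq_add_neg] at h3
        linarith
      · fun_prop
    rw [← harm_int, ← intervalIntegral.integral_sub i1 i4]
    refine le_trans ?_ (int_te n hn)
    rw [← Real.norm_eq_abs]
    apply intervalIntegral.norm_integral_le_of_norm_le (by norm_num)
    · refine MeasureTheory.ae_of_all _ (fun t ht => ?_)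
      have := exp_pow_sub n ht.1 ht.2
      rw [Real.norm_eq_abs]
      rw [show (1 - Real.exp (-(t * n))) / t - (1 - (1 - t) ^ n) / t =
        - ((Real.exp (-(t * n)) - (1 - t) ^ n) / t) by ring, abs_neg]
      exact this
    · apply Continuous.intervalIntegrable; fun_prop
  have a3 : |(harmonic n : ℝ) - (Real.log n + Real.eulerMascheroniConstant)| ≤ 1 / n := by
    have h1 := Real.eulerMascheroniSeq_lt_eulerMascheroniConstant n
    have h2 := Real.eulerMascheroniConstant_lt_eulerMascheroniSeq' n
    rw [Real.eulerMascheroniSeq] at h1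
    rw [Real.eulerMascheroniSeq', if_neg (by omega)] at h2
    have h3 : Real.log (n + 1) - Real.log n ≤ 1 / n := by
      rw [← Real.log_div (by positivity) (by positivity)]
      refine (Real.log_le_sub_one_of_pos (by positivity)).trans (le_of_eq ?_)
      field_simp; ring
    rw [abs_le]; have : (0:ℝ) < 1 / n := by positivity
    constructor <;> linarith
  have e6 : (6:ℝ) / n = 3 / n + 1 / n + 1 / n + 1 / n := by ring
  have : (0:ℝ) < 1 / n := by positivity
  rw [abs_le] at *
  constructor <;> linarith [a1.1, a1.2, a2.1, a2.2, a3.1, a3.2]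

theorem one_sub_cos_le (v : ℝ) : |1 - Real.cos v| ≤ |v| := by
  have h := Real.cos_le_one v
  rw [abs_of_nonneg (by linarith)]
  by_cases hv : |v| ≤ 2
  · have := Real.one_sub_sq_div_two_le_cos (x := v)
    have e := sq_abs v
    nlinarith [abs_nonneg v]
  · have := Real.neg_one_le_cos v
    push Not at hv
    linarith

theorem P3_ii (x y : ℝ) (hx : 0 < x) : IntervalIntegrable
    (fun t => Real.exp (-(t * x)) * (1 - Real.cos (y * t)) / t)
    MeasureTheory.volume 0 Real.pi := by
  apply ii_of_bdd (C := |y|) _ _ Real.pi_pos.le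
  · intro t h0 h1
    have : Real.exp (-(t * x)) ≤ 1 := by
      rw [Real.exp_le_one_iff]; have := mul_pos h0 hx; linarith
    rw [abs_div, abs_mul, abs_of_pos h0, abs_of_pos (Real.exp_pos _), div_le_iff₀ h0]
    calc _ ≤ 1 * |1 - Real.cos (y * t)| := by gcongr
      _ ≤ 1 * |y * t| := mul_le_mul_of_nonneg_left (one_sub_cos_le _) zero_le_one
      _ = _ := by rw [abs_mul, abs_of_pos h0]; ring
  · fun_prop

theorem P3_deriv (x y : ℝ) (hx : 0 < x) :
    HasDerivAt (fun y => ∫ t in (0:ℝ)..Real.pi, Real.exp (-(t * x)) * (1 - Real.cos (y * t)) / t)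
      (∫ t in (0:ℝ)..Real.pi, Real.exp (-(t * x)) * Real.sin (y * t)) y := by
  refine (intervalIntegral.hasDerivAt_integral_of_dominated_loc_of_deriv_le
    (F := fun y t => Real.exp (-(t * x)) * (1 - Real.cos (y * t)) / t)
    (F' := fun y t => Real.exp (-(t * x)) * Real.sin (y * t)) (bound := fun _ => 1)
    (s := Set.univ) Filter.univ_mem ?_ (P3_ii x y hx) ?_ ?_ ?_ ?_).2
  · refine Filter.Eventually.of_forall (fun z => ?_)
    apply Measurable.aestronglyMeasurable
    fun_prop
  · apply Continuous.aestronglyMeasurable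
    fun_prop
  · refine MeasureTheory.ae_of_all _ (fun t ht z _ => ?_)
    rw [Set.uIoc_of_le Real.pi_pos.le] at ht
    have : Real.exp (-(t * x)) ≤ 1 := by
      rw [Real.exp_le_one_iff]; have := mul_pos ht.1 hx; linarith
    rw [norm_mul, Real.norm_eq_abs, Real.norm_eq_abs, abs_of_pos (Real.exp_pos _)]
    have h2 := Real.abs_sin_le_one (z * t)
    calc _ ≤ (1:ℝ) * 1 := by gcongr
      _ = 1 := by norm_num
  · apply Continuous.intervalIntegrable; fun_prop
  · refine MeasureTheory.ae_of_all _ (fun t ht z _ => ?_)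
    rw [Set.uIoc_of_le Real.pi_pos.le] at ht
    have ht0 := ht.1
    have d : HasDerivAt (fun z => Real.cos (z * t)) (- Real.sin (z * t) * (1 * t)) z :=
      ((hasDerivAt_id' z).mul_const t).cos
    refine (((d.const_sub 1).const_mul (Real.exp (-(t * x)))).div_const t).congr_deriv ?_
    field_simp

theorem P3_sin (x y : ℝ) (hx : 0 < x) :
    (∫ t in (0:ℝ)..Real.pi, Real.exp (-(t * x)) * Real.sin (y * t)) = (y -
      Real.exp (-(Real.pi * x)) * (x * Real.sin (y * Real.pi) + y * Real.cos (y * Real.pi))) /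
        (x ^ 2 + y ^ 2) := by
  have hp : 0 < x ^ 2 + y ^ 2 := by positivity
  rw [intervalIntegral.integral_eq_sub_of_hasDerivAt
    (f := fun t : ℝ => - (Real.exp (-(t * x)) * (x * Real.sin (y * t) + y * Real.cos (y * t))) /
        (x ^ 2 + y ^ 2))]
  · simp; ring
  · intro t _
    have d1 : HasDerivAt (fun t : ℝ => Real.exp (-(t * x))) (Real.exp (-(t * x)) * (-(1 * x))) t :=
      (((hasDerivAt_id' t).mul_const x).neg).exp
    have d2 : HasDerivAt (fun t => Real.cos (y * t)) (- Real.sin (y * t) * (y * 1)) t :=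
      ((hasDerivAt_id' t).const_mul y).cos
    have d3 : HasDerivAt (fun t => Real.sin (y * t)) (Real.cos (y * t) * (y * 1)) t :=
      ((hasDerivAt_id' t).const_mul y).sin
    refine (((d1.mul ((d3.const_mul x).add (d2.const_mul y))).neg).div_const _).congr_deriv ?_
    simp only [Pi.add_apply]
    field_simp; ring
  · apply Continuous.intervalIntegrable; fun_prop

theorem P3 (x y : ℝ) (hx : 0 < x) (hy : |y| ≤ x) :
    |(∫ t in (0:ℝ)..Real.pi, Real.exp (-(t * x)) * (1 - Real.cos (y * t)) / t) -
      (1 / 2 * Real.log (x ^ 2 + y ^ 2) - Real.log x)| ≤ 2 / x := by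
  have hd : ∀ z, HasDerivAt (fun y =>
      (∫ t in (0:ℝ)..Real.pi, Real.exp (-(t * x)) * (1 - Real.cos (y * t)) / t) -
      1 / 2 * Real.log (x ^ 2 + y ^ 2))
      (- (Real.exp (-(Real.pi * x)) * (x * Real.sin (z * Real.pi) + z * Real.cos (z * Real.pi))) /
        (x ^ 2 + z ^ 2)) z := by
    intro z
    have hp : 0 < x ^ 2 + z ^ 2 := by positivity
    have d1 : HasDerivAt (fun y : ℝ => x ^ 2 + y ^ 2) (2 * z) z := by
      refine ((hasDerivAt_pow 2 z).const_add (x ^ 2)).congr_deriv ?_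
      simp
    refine ((P3_deriv x z hx).sub ((d1.log hp.ne').const_mul (1 / 2))).congr_deriv ?_
    rw [P3_sin x z hx]
    field_simp; ring
  have hb : ∀ z, ‖- (Real.exp (-(Real.pi * x)) * (x * Real.sin (z * Real.pi) + z * Real.cos (z * Real.pi))) /
        (x ^ 2 + z ^ 2)‖ ≤ Real.exp (-(Real.pi * x)) * (2 / x) := by
    intro z
    have hp : 0 < x ^ 2 + z ^ 2 := by positivity
    rw [norm_div, norm_neg, norm_mul, Real.norm_eq_abs, Real.norm_eq_abs, Real.norm_eq_abs,
      abs_of_pos (Real.exp_pos _), abs_of_pos hp, mul_div_assoc]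
    gcongr ?_ * ?_
    rw [div_le_div_iff₀ hp hx]
    have h1 : |x * Real.sin (z * Real.pi) + z * Real.cos (z * Real.pi)| ≤ x + |z| := by
      refine (abs_add_le _ _).trans ?_
      rw [abs_mul, abs_mul, abs_of_pos hx]
      have := Real.abs_sin_le_one (z * Real.pi)
      have := Real.abs_cos_le_one (z * Real.pi)
      have := abs_nonneg z
      gcongr <;> nlinarith
    have := sq_abs z
    nlinarith [sq_nonneg (x - |z|), abs_nonneg z, sq_nonneg x]
  have := Convex.norm_image_sub_le_of_norm_hasDerivWithin_le (s := Set.univ)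
    (fun z _ => (hd z).hasDerivWithinAt) (fun z _ => hb z) convex_univ (Set.mem_univ 0) (Set.mem_univ y)
  simp only [Real.norm_eq_abs] at this
  have e0 : Real.log (x ^ 2) = 2 * Real.log x := by rw [Real.log_pow]; norm_num
  simp [e0] at this
  have h3 : Real.exp (-(Real.pi * x)) * (2 / x) * |y| ≤ 2 / x := by
    have h4 := exp_bound1 (u := Real.pi * x) (by positivity)
    have h5 := Real.pi_gt_three
    have h6 := Real.exp_pos (-(Real.pi * x))
    calc _ ≤ Real.exp (-(Real.pi * x)) * (2 / x) * x := by gcongr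
      _ = x * Real.exp (-(Real.pi * x)) * 2 / x := by ring
      _ ≤ 1 * 2 / x := by gcongr; nlinarith
      _ = _ := by ring
  refine le_trans (le_of_eq ?_) (this.trans h3)
  congr 1
  ring

/-- integrand of the potential kernel -/
def fk (x y : ℝ) (t : ℝ) : ℝ := (1 - Real.exp (-(al t * |x|)) * Real.cos (y * t)) / Sh t

def ak (z : Site) : ℝ := 1 / (2 * Real.pi) * ∫ t in (0:ℝ)..Real.pi, fk z.1 z.2 t

theorem fk_meas (x y : ℝ) : Measurable (fk x y) := by
  unfold fk
  have := continuous_Sh.measurable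
  have := continuous_al.measurable
  fun_prop

theorem Sh_ge' {t : ℝ} (h0 : 0 < t) (h1 : t ≤ Real.pi) : t / 2 ≤ Sh t := by
  refine le_trans ?_ (Sh_ge h0 h1)
  rw [div_le_div_iff₀ (by norm_num) Real.pi_pos]
  nlinarith [Real.pi_lt_four]

theorem al_nonneg {t : ℝ} (h0 : 0 < t) (h1 : t ≤ Real.pi) : 0 ≤ al t :=
  le_trans (by positivity) (al_ge h0 h1)

theorem fk_bound (x y : ℝ) {t : ℝ} (h0 : 0 < t) (h1 : t ≤ Real.pi) :
    |fk x y t| ≤ 2 * (|x| + |y|) := by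
  have hS := Sh_ge' h0 h1
  have hS0 := Sh_pos h0 h1
  have ha := al_nonneg h0 h1
  have ha2 := al_le h0 h1
  have hu : 0 ≤ al t * |x| := by positivity
  have he : Real.exp (-(al t * |x|)) ≤ 1 := by rw [Real.exp_le_one_iff]; linarith
  have he0 := Real.exp_pos (-(al t * |x|))
  unfold fk
  rw [abs_div, abs_of_pos hS0, div_le_iff₀ hS0]
  have e : 1 - Real.exp (-(al t * |x|)) * Real.cos (y * t) = (1 - Real.exp (-(al t * |x|)))
    + Real.exp (-(al t * |x|)) * (1 - Real.cos (y * t)) := by ring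
  have b1 : |1 - Real.exp (-(al t * |x|))| ≤ t * |x| := by
    rw [abs_of_nonneg (by linarith)]
    refine one_sub_exp_le.trans ?_
    gcongr
  have b2 : |Real.exp (-(al t * |x|)) * (1 - Real.cos (y * t))| ≤ t * |y| := by
    rw [abs_mul, abs_of_pos he0]
    have := one_sub_cos_le (y * t)
    rw [abs_mul, abs_of_pos h0] at this
    calc _ ≤ 1 * |1 - Real.cos (y * t)| := by gcongr
      _ ≤ _ := by linarith
  rw [e]
  refine (abs_add_le _ _).trans ((add_le_add b1 b2).trans ?_)
  have : 2 * (|x| + |y|) * (t / 2) ≤ 2 * (|x| + |y|) * Sh t := by gcongr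
  linarith

theorem fk_bound2 (x y : ℝ) {t : ℝ} (h0 : 0 < t) (h1 : t ≤ Real.pi) :
    |fk x y t| ≤ 4 / t := by
  have hS := Sh_ge' h0 h1
  have hS0 := Sh_pos h0 h1
  have ha := al_nonneg h0 h1
  have hu : 0 ≤ al t * |x| := by positivity
  have he : Real.exp (-(al t * |x|)) ≤ 1 := by rw [Real.exp_le_one_iff]; linarith
  have he0 := Real.exp_pos (-(al t * |x|))
  have hc := Real.abs_cos_le_one (y * t)
  unfold fk
  rw [abs_div, abs_of_pos hS0, div_le_div_iff₀ hS0 h0]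
  have : |1 - Real.exp (-(al t * |x|)) * Real.cos (y * t)| ≤ 2 := by
    refine (abs_sub _ _).trans ?_
    rw [abs_mul, abs_of_pos he0, abs_one]
    have : Real.exp (-(al t * |x|)) * |Real.cos (y * t)| ≤ 1 * 1 := by gcongr
    linarith
  nlinarith

theorem fk_ii (x y : ℝ) : IntervalIntegrable (fk x y) MeasureTheory.volume 0 Real.pi :=
  ii_of_bdd (fk_meas x y) _ _ Real.pi_pos.le (fun _ h0 h1 => fk_bound x y h0 h1)

theorem ak_growth (z : Site) : |ak z| ≤ 4 * √(|(z.1:ℝ)| + |(z.2:ℝ)|) := by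
  have hpi := Real.pi_gt_three
  set R := |(z.1:ℝ)| + |(z.2:ℝ)| with hR
  have hR0 : 0 ≤ R := by positivity
  have h1 : |∫ t in (0:ℝ)..Real.pi, fk z.1 z.2 t| ≤
      ∫ t in (0:ℝ)..Real.pi, √(8 * R) * t ^ (-(1/2) : ℝ) := by
    rw [← Real.norm_eq_abs]
    apply intervalIntegral.norm_integral_le_of_norm_le (by linarith)
    · refine MeasureTheory.ae_of_all _ (fun t ht => ?_)
      have b1 := fk_bound z.1 z.2 ht.1 ht.2
      have b2 := fk_bound2 z.1 z.2 ht.1 ht.2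
      have ht0 := ht.1
      rw [Real.norm_eq_abs, Real.rpow_neg ht.1.le, ← Real.sqrt_eq_rpow, ← Real.sqrt_inv,
        ← Real.sqrt_mul (by positivity)]
      apply Real.le_sqrt_of_sq_le
      rw [sq]
      calc _ ≤ (2 * R) * (4 / t) := by gcongr
        _ = _ := by ring
    · apply IntervalIntegrable.const_mul
      apply intervalIntegral.intervalIntegrable_rpow'
      norm_num
  rw [intervalIntegral.integral_const_mul, integral_rpow (by left; norm_num)] at h1
  norm_num at h1
  rw [← Real.sqrt_eq_rpow] at h1
  unfold ak
  rw [abs_mul, abs_of_pos (by positivity)]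
  have h8 : √8 ≤ 3 := by rw [Real.sqrt_le_left] <;> norm_num
  have h9 : √Real.pi ≤ 2 := by
    rw [Real.sqrt_le_left (by norm_num)]; linarith [Real.pi_lt_four]
  rw [one_div, inv_mul_le_iff₀ (by positivity)]
  refine h1.trans ?_
  have := Real.sqrt_nonneg R
  have := Real.sqrt_nonneg Real.pi
  calc √8 * √R * (√Real.pi / (1 / 2)) ≤ 3 * √R * (2 / (1 / 2)) := by gcongr
    _ ≤ 2 * 3 * (4 * √R) := by nlinarith
    _ ≤ 2 * Real.pi * (4 * √R) := by gcongr

theorem ak_neg1 (x y : ℤ) : ak (-x, y) = ak (x, y) := by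
  simp [ak, fk]

theorem ak_neg2 (x y : ℤ) : ak (x, -y) = ak (x, y) := by
  simp [ak, fk]

theorem ak_zero : ak (0, 0) = 0 := by
  simp [ak, fk]

theorem fk_lap (x y : ℤ) {t : ℝ} (h0 : 0 < t) (h1 : t ≤ Real.pi) :
    fk (x + 1) y t + fk (x - 1) y t + fk x (y + 1) t + fk x (y - 1) t - 4 * fk x y t =
      if x = 0 then 2 * Real.cos (y * t) else 0 := by
  have hS0 := Sh_pos h0 h1
  have hS : Sh t = (Real.exp (al t) - Real.exp (-al t)) / 2 := by
    rw [← sinh_al, Real.sinh_eq]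
  have hC : Real.cos t = 2 - (Real.exp (al t) + Real.exp (-al t)) / 2 := by
    have := cosh_al t
    rw [Real.cosh_eq] at this; linarith
  have hcc : Real.cos ((y + 1) * t) + Real.cos ((y - 1) * t) = 2 * Real.cos (y * t) * Real.cos t := by
    rw [add_mul, sub_mul, one_mul, Real.cos_add, Real.cos_sub]; ring
  have main : ∀ k : ℝ, (|(x:ℝ) + 1| = |(x:ℝ)| + 1 ∧ |(x:ℝ) - 1| = |(x:ℝ)| - 1) ∨
      (|(x:ℝ) - 1| = |(x:ℝ)| + 1 ∧ |(x:ℝ) + 1| = |(x:ℝ)| - 1) →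
      fk (x + 1) y t + fk (x - 1) y t + fk x (y + 1) t + fk x (y - 1) t - 4 * fk x y t = 0 := by
    intro _ h
    have e1 : Real.exp (-(al t * (|(x:ℝ)| + 1))) = Real.exp (-(al t * |(x:ℝ)|)) * Real.exp (-al t) := by
      rw [← Real.exp_add]; ring_nf
    have e2 : Real.exp (-(al t * (|(x:ℝ)| - 1))) = Real.exp (-(al t * |(x:ℝ)|)) * Real.exp (al t) := by
      rw [← Real.exp_add]; ring_nf
    unfold fk
    rw [← add_div, ← add_div, ← add_div, mul_div, ← sub_div, div_eq_zero_iff]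
    left
    rcases h with ⟨h1, h2⟩ | ⟨h1, h2⟩ <;> rw [h1, h2, e1, e2] <;>
    linear_combination (-Real.exp (-(al t * |(x:ℝ)|))) * hcc
      - 2 * Real.exp (-(al t * |(x:ℝ)|)) * Real.cos (y * t) * hC
  rcases lt_trichotomy x 0 with hx | hx | hx
  · have : (x:ℝ) ≤ -1 := by exact_mod_cast (by omega : x ≤ -1)
    rw [if_neg hx.ne]
    apply main 0
    right
    rw [abs_of_neg (by linarith : (x:ℝ) < 0), abs_of_neg (by linarith), abs_of_nonpos (by linarith)]
    constructor <;> ring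
  · subst hx
    simp only [if_true, fk, Int.cast_zero]
    rw [← add_div, ← add_div, ← add_div, mul_div, ← sub_div, div_eq_iff hS0.ne']
    simp
    rw [hS]
    linear_combination -hcc - 2 * Real.cos (y * t) * hC
  · have : (1:ℝ) ≤ x := by exact_mod_cast (by omega : 1 ≤ x)
    rw [if_neg hx.ne']
    apply main 0
    left
    rw [abs_of_pos (by linarith : (0:ℝ) < x), abs_of_pos (by linarith), abs_of_nonneg (by linarith)]
    simp

theorem int_cos (y : ℤ) : ∫ t in (0:ℝ)..Real.pi, 2 * Real.cos (y * t) =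
    if y = 0 then 2 * Real.pi else 0 := by
  split
  · rename_i h; subst h; simp; ring
  · rename_i h
    have hy : (y:ℝ) ≠ 0 := by exact_mod_cast h
    rw [intervalIntegral.integral_const_mul, intervalIntegral.integral_comp_mul_left _ hy,
      integral_cos]
    simp

theorem ak_lap (z : Site) : lap ak z = if z = (0, 0) then 1 else 0 := by
  obtain ⟨x, y⟩ := z
  have hpi := Real.pi_pos
  have i0 := fk_ii x y
  have i1 := fk_ii (x + 1) y
  have i2 := fk_ii (x - 1) y
  have i3 := fk_ii x (y + 1)
  have i4 := fk_ii x (y - 1)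
  have e : lap ak (x, y) = 1 / (2 * Real.pi) * ∫ t in (0:ℝ)..Real.pi,
      (fk (x + 1) y t + fk (x - 1) y t + fk x (y + 1) t + fk x (y - 1) t - 4 * fk x y t) := by
    rw [intervalIntegral.integral_sub (((i1.add i2).add i3).add i4) (i0.const_mul 4),
      intervalIntegral.integral_add ((i1.add i2).add i3) i4,
      intervalIntegral.integral_add (i1.add i2) i3,
      intervalIntegral.integral_add i1 i2, intervalIntegral.integral_const_mul]
    simp only [lap, ak]
    push_cast
    ring
  have e2 : (∫ t in (0:ℝ)..Real.pi,
      (fk (x + 1) y t + fk (x - 1) y t + fk x (y + 1) t + fk x (y - 1) t - 4 * fk x y t)) =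
      ∫ t in (0:ℝ)..Real.pi, if x = 0 then 2 * Real.cos (y * t) else 0 := by
    apply intervalIntegral.integral_congr_ae
    refine MeasureTheory.ae_of_all _ (fun t ht => ?_)
    rw [Set.uIoc_of_le hpi.le] at ht
    exact fk_lap x y ht.1 ht.2
  rw [e, e2]
  by_cases hx : x = 0
  · simp only [hx, if_true, int_cos]
    by_cases hy : y = 0
    · simp [hy]; field_simp
    · simp [hy]
  · simp [hx]

theorem wedge_aux (f : Site → ℝ) (hf : ∀ z, lap f z = 0)
    (hd : ∀ z : Site, |z.2| = z.1 → f z = 0) (C : ℝ)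
    (hg : ∀ z : Site, |z.2| ≤ z.1 → f z ≤ C * √(z.1 : ℝ)) :
    ∀ z : Site, |z.2| ≤ z.1 → f z ≤ 0 := by
  intro z hz
  have hz0 : 0 ≤ z.1 := (abs_nonneg _).trans hz
  have key : ∀ ε : ℝ, 0 < ε → f z ≤ ε * z.1 := by
    intro ε hε
    obtain ⟨n, hn⟩ := exists_nat_gt (max ((C / ε) ^ 2) (z.1 : ℝ))
    have hn1 := (le_max_left _ _).trans_lt hn
    have hn2 := (le_max_right _ _).trans_lt hn
    have hn2' : z.1 < n := by exact_mod_cast hn2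
    rcases hz.eq_or_lt with h | h
    · rw [hd z h]
      have : (0:ℝ) ≤ z.1 := by exact_mod_cast hz0
      positivity
    · let D : Finset Site := (box n).filter (fun w => |w.2| < w.1 ∧ w.1 < n)
      have hD : ∀ w : Site, w ∈ D ↔ |w.2| < w.1 ∧ w.1 < n := by
        intro w
        simp only [D, box, Finset.mem_filter, Finset.mem_product, Finset.mem_Icc,
          and_iff_right_iff_imp, abs_lt]
        omega
      have := max_principle D (fun w => f w - ε * w.1) 0 ?_ ?_ z ((hD z).mpr ⟨h, hn2'⟩)
      · linarith
      · intro w _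
        have e : lap (fun w => f w - ε * w.1) w = lap f w := by
          simp only [lap]; push_cast; ring
        rw [e, hf]
      · intro w hw v hv hwv
        rw [hD] at hw hv
        have hv1 : |v.2| ≤ v.1 ∧ v.1 ≤ n := by
          rw [adjP_iff] at hwv
          rw [abs_lt] at hw
          rw [abs_le]
          rcases hwv with rfl | rfl | rfl | rfl <;> simp <;> omega
        have hv0 : (0:ℝ) ≤ v.1 := by exact_mod_cast (abs_nonneg _).trans hv1.1
        rcases hv1.1.eq_or_lt with h2 | h2
        · simp only [hd v h2]
          have : 0 ≤ ε * v.1 := by positivity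
          linarith
        · have h3 : v.1 = n := by
            by_contra h4
            exact hv ⟨h2, lt_of_le_of_ne hv1.2 h4⟩
          have h4 := hg v hv1.1
          have h5 : (v.1 : ℝ) = n := by exact_mod_cast h3
          rw [h5] at h4
          simp only [h5]
          have h6 : C / ε ≤ √(n:ℝ) := Real.le_sqrt_of_sq_le hn1.le
          have h7 : C ≤ ε * √(n:ℝ) := by rw [div_le_iff₀ hε] at h6; linarith
          have h8 : √(n:ℝ) * √(n:ℝ) = n := Real.mul_self_sqrt (by positivity)
          have h9 := Real.sqrt_nonneg (n:ℝ)
          nlinarith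
  have hz0' : (0:ℝ) ≤ z.1 := by exact_mod_cast hz0
  by_contra hcon
  push Not at hcon
  have := key (f z / (2 * (z.1 + 1))) (by positivity)
  rw [div_mul_eq_mul_div, le_div_iff₀ (by positivity)] at this
  nlinarith

theorem ak_symm_wedge (x y : ℤ) (h : |y| ≤ x) : ak (x, y) = ak (y, x) := by
  have hlap : ∀ z : Site, lap (fun z => ak (z.2, z.1)) z = if z = (0, 0) then 1 else 0 := by
    intro z
    have h1 := ak_lap (z.2, z.1)
    have e : lap (fun z => ak (z.2, z.1)) z = lap ak (z.2, z.1) := by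
      simp only [lap]; ring
    rw [e, h1]
    simp [Prod.ext_iff, and_comm]
  have hdiag : ∀ z : Site, |z.2| = z.1 → ak z = ak (z.2, z.1) := by
    rintro ⟨a, b⟩ hz
    simp only at hz ⊢
    rcases abs_choice b with hb | hb
    · rw [hb] at hz; rw [hz]
    · rw [hb] at hz; rw [← hz, ak_neg1, ak_neg2]
  have hgr : ∀ z : Site, |z.2| ≤ z.1 → |ak z| + |ak (z.2, z.1)| ≤ 16 * √(z.1 : ℝ) := by
    intro z hz
    have h1 := ak_growth z
    have h2 := ak_growth (z.2, z.1)
    simp only at h2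
    have hz' : |(z.2:ℝ)| ≤ z.1 := by exact_mod_cast hz
    have h3 : |(z.1:ℝ)| = z.1 := abs_of_nonneg ((abs_nonneg _).trans hz')
    have h4 : |(z.1:ℝ)| + |(z.2:ℝ)| ≤ 4 * z.1 := by rw [h3]; linarith [(abs_nonneg _).trans hz']
    have h5 : √(|(z.1:ℝ)| + |(z.2:ℝ)|) ≤ 2 * √(z.1:ℝ) := by
      refine (Real.sqrt_le_sqrt h4).trans (le_of_eq ?_)
      rw [Real.sqrt_mul (by norm_num), show (4:ℝ) = 2 ^ 2 by norm_num, Real.sqrt_sq (by norm_num)]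
    rw [add_comm (|(z.2:ℝ)|)] at h2
    linarith
  have w1 := wedge_aux (fun z => ak z - ak (z.2, z.1))
    (fun z => by
      have e : lap (fun z => ak z - ak (z.2, z.1)) z = lap ak z - lap (fun z => ak (z.2, z.1)) z := by
        simp only [lap]; ring
      rw [e, hlap, ak_lap]; simp)
    (fun z hz => by rw [hdiag z hz]; ring) 16
    (fun z hz => by
      have := hgr z hz
      have := le_abs_self (ak z)
      have := neg_abs_le (ak (z.2, z.1))
      linarith) (x, y) h
  have w2 := wedge_aux (fun z => ak (z.2, z.1) - ak z)
    (fun z => by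
      have e : lap (fun z => ak (z.2, z.1) - ak z) z = lap (fun z => ak (z.2, z.1)) z - lap ak z := by
        simp only [lap]; ring
      rw [e, hlap, ak_lap]; simp)
    (fun z hz => by rw [hdiag z hz]; ring) 16
    (fun z hz => by
      have := hgr z hz
      have := neg_abs_le (ak z)
      have := le_abs_self (ak (z.2, z.1))
      linarith) (x, y) h
  simp only at w1 w2
  linarith

theorem P4_ii (x y : ℝ) (hx : 0 < x) : IntervalIntegrable
    (fun t => Real.cos (y * t) * (Real.exp (-(al t * x)) / Sh t - Real.exp (-(t * x)) / t))
    MeasureTheory.volume 0 Real.pi ∧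
    |∫ t in (0:ℝ)..Real.pi,
      Real.cos (y * t) * (Real.exp (-(al t * x)) / Sh t - Real.exp (-(t * x)) / t)| ≤ 400 / x := by
  have hb : ∀ t, 0 < t → t ≤ Real.pi →
      |Real.cos (y * t) * (Real.exp (-(al t * x)) / Sh t - Real.exp (-(t * x)) / t)| ≤ 100 / x := by
    intro t h0 h1
    rw [abs_mul]
    have h2 := P4_pt h0 h1 hx
    have h3 := Real.abs_cos_le_one (y * t)
    calc _ ≤ 1 * (100 / x) := by gcongr
      _ = _ := by ring
  constructor
  · apply ii_of_bdd (C := 100 / x) _ _ Real.pi_pos.le hb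
    have := continuous_Sh.measurable
    have := continuous_al.measurable
    fun_prop
  · refine (ii_bound _ _ _ Real.pi_pos.le hb).trans ?_
    have := Real.pi_lt_four
    rw [div_mul_eq_mul_div]
    gcongr; linarith

theorem ak_asym_wedge (n : ℕ) (hn : 1 ≤ n) (y : ℤ) (hy : |(y:ℝ)| ≤ n) :
    |2 * Real.pi * ak (n, y) - (1 / 2 * Real.log ((n:ℝ) ^ 2 + (y:ℝ) ^ 2) + κconst)| ≤ 408 / n := by
  have hn0 : (0:ℝ) < n := by exact_mod_cast hn
  have hpi := Real.pi_pos
  have j1 : IntervalIntegrable (fun t => 1 / Sh t - 1 / t) MeasureTheory.volume 0 Real.pi := by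
    apply ii_of_bdd (C := Real.pi) _ _ hpi.le
    · intro t h0 h1; exact (inv_sub h0 h1).trans h1
    · have := continuous_Sh.measurable
      fun_prop
  have j2 := P2_ii n Real.pi hpi.le hn0.le
  have j3 := P3_ii n y hn0
  have j4 := P4_ii n y hn0
  have e : 2 * Real.pi * ak (n, y) = (∫ t in (0:ℝ)..Real.pi, (1 / Sh t - 1 / t)) +
      (∫ t in (0:ℝ)..Real.pi, (1 - Real.exp (-(t * n))) / t) +
      (∫ t in (0:ℝ)..Real.pi, Real.exp (-(t * n)) * (1 - Real.cos (y * t)) / t) -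
      (∫ t in (0:ℝ)..Real.pi,
        Real.cos (y * t) * (Real.exp (-(al t * n)) / Sh t - Real.exp (-(t * n)) / t)) := by
    rw [← intervalIntegral.integral_add j1 j2, ← intervalIntegral.integral_add (j1.add j2) j3,
      ← intervalIntegral.integral_sub ((j1.add j2).add j3) j4.1]
    unfold ak
    rw [← mul_assoc, mul_one_div_cancel (by positivity), one_mul]
    congr 1
    funext t
    simp only [fk, Int.cast_natCast, Nat.abs_cast]
    ring
  have k2 := P2 n hn
  have k3 := P3 n y hn0 hy
  have k4 := j4.2
  rw [e, P1]
  have e4 : (408:ℝ) / n = 400 / n + 6 / n + 2 / n := by ring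
  unfold κconst
  rw [e4]
  rw [abs_le] at *
  constructor <;> linarith [k2.1, k2.2, k3.1, k3.2, k4.1, k4.2]

theorem ak_abs (x y : ℤ) : ak (|x|, |y|) = ak (x, y) := by
  have h1 : ak (|x|, |y|) = ak (x, |y|) := by
    rcases abs_choice x with h | h <;> rw [h]
    rw [ak_neg1]
  rw [h1]
  rcases abs_choice y with h | h <;> rw [h]
  rw [ak_neg2]

theorem ak_asym_wedge' (x y : ℤ) (hx : 1 ≤ x) (hy : |y| ≤ x) :
    |2 * Real.pi * ak (x, y) - (1 / 2 * Real.log ((x:ℝ) ^ 2 + (y:ℝ) ^ 2) + κconst)| ≤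
      816 / √((x:ℝ) ^ 2 + (y:ℝ) ^ 2) := by
  obtain ⟨n, rfl⟩ := Int.eq_ofNat_of_zero_le (by omega : 0 ≤ x)
  have hy' : |(y:ℝ)| ≤ n := by exact_mod_cast hy
  have hn : 1 ≤ n := by omega
  have hn0 : (0:ℝ) < n := by exact_mod_cast hn
  have := ak_asym_wedge n hn y hy'
  simp only [Int.cast_natCast]
  refine this.trans ?_
  rw [div_le_div_iff₀ hn0 (by positivity)]
  have h2 : √((n:ℝ) ^ 2 + (y:ℝ) ^ 2) ≤ 2 * n := by
    rw [Real.sqrt_le_left (by positivity)]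
    have := sq_abs (y:ℝ)
    nlinarith [abs_nonneg (y:ℝ)]
  linarith

theorem ak_asym (x y : ℤ) (h : (x, y) ≠ ((0, 0) : Site)) :
    |2 * Real.pi * ak (x, y) - (1 / 2 * Real.log ((x:ℝ) ^ 2 + (y:ℝ) ^ 2) + κconst)| ≤
      816 / √((x:ℝ) ^ 2 + (y:ℝ) ^ 2) := by
  have hne : 1 ≤ |x| ∨ 1 ≤ |y| := by
    by_contra hc
    push Not at hc
    have h1 := Int.abs_lt_one_iff.mp hc.1
    have h2 := Int.abs_lt_one_iff.mp hc.2
    exact h (by rw [h1, h2])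
  rcases le_total |y| |x| with hxy | hxy
  · have := ak_asym_wedge' |x| |y| (by omega) (by rwa [abs_abs])
    rw [ak_abs] at this
    simpa using this
  · have := ak_asym_wedge' |y| |x| (by omega) (by rwa [abs_abs])
    rw [ak_symm_wedge _ _ (by rwa [abs_abs]), ak_abs] at this
    push_cast at this
    rw [sq_abs, sq_abs, add_comm ((y:ℝ) ^ 2)] at this
    exact this

theorem kappa_pos : 0 < κconst := by
  unfold κconst
  have := Real.one_half_lt_eulerMascheroniConstant
  have := Real.log_pos (by norm_num : (1:ℝ) < 2)
  linarith

theorem part_one (r : ℝ) (hr : 2 ≤ r) (h : ℝ) :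
    |Ir r h - 2 * Real.pi * h ^ 2 / (Real.log r + κconst)| ≤
      (3268 / r) * h ^ 2 / (Real.log r + κconst) := by
  have hpi := Real.pi_pos
  have hr0 : 0 < r := by linarith
  set L := Real.log r + κconst with hL
  have hL0 : 0 < L := by
    have := Real.log_pos (by linarith : 1 < r)
    have := kappa_pos
    linarith
  obtain ⟨g, g1, g2, g3, g4⟩ := Ir_eq_green r (by linarith) ak ak_lap ak_zero
    ((L - 817 / r) / (2 * Real.pi)) ((L + 817 / r) / (2 * Real.pi)) (by
    rintro ⟨x, y⟩ h1 h2
    simp only at h1 h2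
    have hne : (x, y) ≠ ((0, 0) : Site) := by
      rintro h
      simp only [Prod.mk.injEq] at h
      rw [h.1, h.2] at h1
      norm_num at h1
      nlinarith
    have ha := ak_asym x y hne
    set P := (x:ℝ) ^ 2 + (y:ℝ) ^ 2
    have hP0 : 0 < P := lt_trans (by positivity) h1
    have hs : r ≤ √P := Real.le_sqrt_of_sq_le h1.le
    have k1 : 816 / √P ≤ 816 / r := by gcongr
    have k2 : Real.log r ≤ 1 / 2 * Real.log P := by
      have := Real.log_le_log (by positivity) h1.le
      rw [Real.log_pow] at this
      push_cast at this; linarith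
    have k3 : 1 / 2 * Real.log P ≤ Real.log r + 1 / r := by
      have := Real.log_le_log hP0 h2
      rw [Real.log_pow] at this
      push_cast at this
      have h3 : Real.log (r + 1) - Real.log r ≤ 1 / r := by
        rw [← Real.log_div (by positivity) (by positivity)]
        refine (Real.log_le_sub_one_of_pos (by positivity)).trans (le_of_eq ?_)
        field_simp; ring
      linarith
    have e : 817 / r = 816 / r + 1 / r := by ring
    have e0 : 0 < 1 / r := by positivity
    rw [abs_le] at ha
    rw [div_le_iff₀ (by positivity), le_div_iff₀ (by positivity)]
    constructor <;> linarith [ha.1, ha.2])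
  rw [div_le_iff₀ (by positivity)] at g2
  rw [le_div_iff₀ (by positivity)] at g3
  have hg0 : 0 < g := by linarith
  rw [g4 h]
  have e : h ^ 2 / g - 2 * Real.pi * h ^ 2 / L = h ^ 2 * (L - g * (2 * Real.pi)) / (g * L) := by
    field_simp
  have hd : |L - g * (2 * Real.pi)| ≤ 817 / r := by rw [abs_le]; constructor <;> linarith
  rw [e, abs_div, abs_mul, abs_of_nonneg (sq_nonneg h), abs_of_pos (by positivity : 0 < g * L),
    ← div_div]
  gcongr
  rw [div_le_iff₀ hg0]
  calc _ ≤ h ^ 2 * (817 / r) := by gcongr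
    _ = 3268 / r * h ^ 2 * (1 / 4) := by ring
    _ ≤ _ := by gcongr

theorem part_two (r : ℝ → ℝ) (c₁ c₂ : ℝ) (hc₁ : 0 < c₁)
    (hr : ∀ h : ℝ, 2 ≤ h → c₁ ≤ r h * Real.log h / h ∧ r h * Real.log h / h ≤ c₂) :
    Tendsto (fun h : ℝ => Ir (r h) h / (2 * Real.pi * h ^ 2 / Real.log h)) atTop (𝓝 1) := by
  have hpi := Real.pi_pos
  have hrt : Tendsto r atTop atTop := by
    have h1 : Tendsto (fun h : ℝ => c₁ / 2 * √h) atTop atTop :=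
      Real.tendsto_sqrt_atTop.const_mul_atTop (by positivity)
    apply tendsto_atTop_mono' _ _ h1
    filter_upwards [eventually_ge_atTop 2] with h hh
    have h2 := (hr h hh).1
    have hh0 : 0 < h := by linarith
    have hl : 0 < Real.log h := Real.log_pos (by linarith)
    have h3 : Real.log h ≤ 2 * √h := by
      have := Real.log_le_sub_one_of_pos (x := √h) (by positivity)
      rw [Real.log_sqrt hh0.le] at this
      linarith
    rw [le_div_iff₀ hh0] at h2
    have h4 : √h * √h = h := Real.mul_self_sqrt hh0.le
    have h5 : 0 < √h := by positivity
    have h6 : c₁ / 2 * √h * Real.log h ≤ r h * Real.log h := by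
      refine le_trans ?_ h2
      calc _ ≤ c₁ / 2 * √h * (2 * √h) := by gcongr
        _ = c₁ * (√h * √h) := by ring
        _ = _ := by rw [h4]
    exact le_of_mul_le_mul_right h6 hl
  have hlog := Real.tendsto_log_atTop
  have hq : Tendsto (fun h => (Real.log (r h * Real.log h / h) + κconst) / Real.log h) atTop (𝓝 0) := by
    apply tendsto_bdd_div_atTop_nhds_zero (b := Real.log c₁ + κconst) (B := Real.log c₂ + κconst) _ _ hlog
    · filter_upwards [eventually_ge_atTop 2] with h hh
      have := Real.log_le_log hc₁ (hr h hh).1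
      linarith
    · filter_upwards [eventually_ge_atTop 2] with h hh
      have := Real.log_le_log (lt_of_lt_of_le hc₁ (hr h hh).1) (hr h hh).2
      linarith
  have hll : Tendsto (fun h => Real.log (Real.log h) / Real.log h) atTop (𝓝 0) :=
    (Real.isLittleO_log_id_atTop.tendsto_div_nhds_zero).comp hlog
  have hL : Tendsto (fun h => (Real.log (r h) + κconst) / Real.log h) atTop (𝓝 1) := by
    have := (hq.add (tendsto_const_nhds (x := (1:ℝ)))).sub hll
    simp only [zero_add, sub_zero] at this
    refine this.congr' ?_
    filter_upwards [eventually_gt_atTop 2, hrt.eventually_gt_atTop 0] with h hh hr0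
    have hl : 0 < Real.log h := Real.log_pos (by linarith)
    rw [Real.log_div (by positivity) (by positivity), Real.log_mul (by positivity) (by positivity)]
    field_simp; ring
  have hLi : Tendsto (fun h => Real.log h / (Real.log (r h) + κconst)) atTop (𝓝 1) := by
    have := hL.inv₀ one_ne_zero
    simpa using this
  have herr : Tendsto (fun h => (3268 / (2 * Real.pi)) * (r h)⁻¹ *
      (Real.log h / (Real.log (r h) + κconst))) atTop (𝓝 0) := by
    have := ((tendsto_inv_atTop_zero.comp hrt).const_mul (3268 / (2 * Real.pi))).mul hLi
    simpa using this
  have hdiff : Tendsto (fun h => Ir (r h) h / (2 * Real.pi * h ^ 2 / Real.log h) -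
      Real.log h / (Real.log (r h) + κconst)) atTop (𝓝 0) := by
    apply squeeze_zero_norm' _ herr
    filter_upwards [eventually_gt_atTop 2, hrt.eventually_ge_atTop 2] with h hh hr2
    have hl : 0 < Real.log h := Real.log_pos (by linarith)
    have hp := part_one (r h) hr2 h
    have hL0 : 0 < Real.log (r h) + κconst := by
      have := Real.log_pos (by linarith : 1 < r h)
      have := kappa_pos
      linarith
    have hr0 : 0 < r h := by linarith
    have hh0 : 0 < h := by linarith
    have hD : 0 < Real.log h / (2 * Real.pi * h ^ 2) := by positivity
    have e : Ir (r h) h / (2 * Real.pi * h ^ 2 / Real.log h) -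
      Real.log h / (Real.log (r h) + κconst) =
      (Ir (r h) h - 2 * Real.pi * h ^ 2 / (Real.log (r h) + κconst)) *
        (Real.log h / (2 * Real.pi * h ^ 2)) := by
      field_simp
    rw [e, Real.norm_eq_abs, abs_mul, abs_of_pos hD]
    calc _ ≤ (3268 / r h) * h ^ 2 / (Real.log (r h) + κconst) *
        (Real.log h / (2 * Real.pi * h ^ 2)) := by gcongr
      _ = _ := by field_simp
  have := hdiff.add hLi
  simpa using this

/-- **Lemma 2.2.** `I_r(h) = (2π + O(1/r)) h²/(log r + κ)`; in particular, for any
`r = r(h) ≍ h / log h` one has `I_{r(h)}(h) ∼ 2π h² / log h` as `h → ∞`. -/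
theorem Ir_asymptotics :
    ∃ C > (0 : ℝ),
      (∀ r : ℝ, 2 ≤ r → ∀ h : ℝ,
        |Ir r h - 2 * Real.pi * h ^ 2 / (Real.log r + κconst)| ≤
          (C / r) * h ^ 2 / (Real.log r + κconst)) ∧
      (∀ (r : ℝ → ℝ) (c₁ c₂ : ℝ), 0 < c₁ → 0 < c₂ →
        (∀ h : ℝ, 2 ≤ h → c₁ ≤ r h * Real.log h / h ∧ r h * Real.log h / h ≤ c₂) →
        Tendsto (fun h : ℝ => Ir (r h) h / (2 * Real.pi * h ^ 2 / Real.log h))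
          atTop (𝓝 1)) := by
  exact ⟨3268, by norm_num, part_one, fun r c₁ c₂ h1 _ h => part_two r c₁ c₂ h1 h⟩
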